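/- In a unit-capacity network (u ≡ 1), for every reroutable s-t-flow x there exists a strictly reroutable s-t-flow x' with val(x') = val(x) and x'(a) ≤ x(a) for all arcs a ∈ A. -/

import Mathlib

open scoped BigOperators

variable {V A : Type}

/-- `IsWalk tl hd v w L`: the list of arcs `L` forms a walk from `v` to `w`
in the digraph whose arcs `a` go from `tl a` to `hd a`. -/
def IsWalk (tl hd : A → V) : V → V → List A → Prop
  | v, w, [] => v = w
  | v, w, a :: L => tl a = v ∧ IsWalk tl hd (hd a) w L

/-- A simple path from `v` to `w`: a walk visiting no vertex twice. -/
def IsPath (tl hd : A → V) (v w : V) (L : List A) : Prop :=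
  IsWalk tl hd v w L ∧ (v :: L.map hd).Nodup

/-- `Before L b a`: the list `L` traverses `b` (strictly) before `a`. -/
def Before (L : List A) (b a : A) : Prop :=
  ∃ l₁ l₂ l₃ : List A, L = l₁ ++ b :: (l₂ ++ a :: l₃)

/-- Sum of a path-flow over a set of paths. -/
noncomputable def sumOver (x : List A → ℝ) (S : Set (List A)) : ℝ :=
  ∑ᶠ P ∈ S, x P

/-- Flow value `x(a)` on an arc `a`: total flow on `s`-`t`-paths through `a`. -/
noncomputable def arcFlow (tl hd : A → V) (s t : V) (x : List A → ℝ) (a : A) : ℝ :=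
  sumOver x {P | IsPath tl hd s t P ∧ a ∈ P}

/-- The value of a flow: total flow on all `s`-`t`-paths. -/
noncomputable def flowVal (tl hd : A → V) (s t : V) (x : List A → ℝ) : ℝ :=
  sumOver x {P | IsPath tl hd s t P}

/-- An `s`-`t`-(path-)flow: nonnegative, supported on simple `s`-`t`-paths,
respecting the arc capacities `u`. -/
def IsFlow (tl hd : A → V) (s t : V) (u : A → ℝ) (x : List A → ℝ) : Prop :=
  (∀ P, 0 ≤ x P) ∧ (∀ P, ¬ IsPath tl hd s t P → x P = 0) ∧
    ∀ a : A, arcFlow tl hd s t x a ≤ u a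

/-- Available capacity `ū_{x,b}(a)` of arc `a` after failure of arc `b`:
`u(a)` minus the flow on paths through `a` that do not traverse `b` before `a`. -/
noncomputable def availCap (tl hd : A → V) (s t : V) (u : A → ℝ) (x : List A → ℝ)
    (b a : A) : ℝ :=
  u a - sumOver x {P | IsPath tl hd s t P ∧ a ∈ P ∧ ¬ Before P b a}

/-- Arc flow of a rerouting flow `y` for failing arc `b`: `y` lives on
`tl b`-`t`-paths avoiding `b`. -/
noncomputable def reArcFlow (tl hd : A → V) (t : V) (b : A) (y : List A → ℝ) (a : A) : ℝ :=
  sumOver y {Q | IsPath tl hd (tl b) t Q ∧ b ∉ Q ∧ a ∈ Q}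

/-- Value of a rerouting flow `y` for failing arc `b`. -/
noncomputable def reVal (tl hd : A → V) (t : V) (b : A) (y : List A → ℝ) : ℝ :=
  sumOver y {Q | IsPath tl hd (tl b) t Q ∧ b ∉ Q}

/-- `y` is a rerouting of `x` for the failing arc `b`: a `tl b`-`t`-flow of value
`x(b)` in `(V, A ∖ {b})` with capacities `ū_{x,b}`. -/
def IsRerouting (tl hd : A → V) (s t : V) (u : A → ℝ) (x : List A → ℝ) (b : A)
    (y : List A → ℝ) : Prop :=
  (∀ Q, 0 ≤ y Q) ∧
  (∀ Q, ¬ (IsPath tl hd (tl b) t Q ∧ b ∉ Q) → y Q = 0) ∧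
  (∀ a : A, a ≠ b → reArcFlow tl hd t b y a ≤ availCap tl hd s t u x b a) ∧
  reVal tl hd t b y = arcFlow tl hd s t x b

/-- `y` is a strict rerouting of `x` for the failing arc `b`: a `tl b`-`t`-flow
of value `x(b)` in `(V, A ∖ {b})` with `y(a) ≤ u(a) - x(a)` for all `a ≠ b`. -/
def IsStrictRerouting (tl hd : A → V) (s t : V) (u : A → ℝ) (x : List A → ℝ) (b : A)
    (y : List A → ℝ) : Prop :=
  (∀ Q, 0 ≤ y Q) ∧
  (∀ Q, ¬ (IsPath tl hd (tl b) t Q ∧ b ∉ Q) → y Q = 0) ∧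
  (∀ a : A, a ≠ b → reArcFlow tl hd t b y a ≤ u a - arcFlow tl hd s t x a) ∧
  reVal tl hd t b y = arcFlow tl hd s t x b

/-- `x` is reroutable: a rerouting exists for every failing arc. -/
def Reroutable (tl hd : A → V) (s t : V) (u : A → ℝ) (x : List A → ℝ) : Prop :=
  ∀ b : A, ∃ y : List A → ℝ, IsRerouting tl hd s t u x b y

/-- `x` is strictly reroutable: a strict rerouting exists for every failing arc. -/
def StrictlyReroutable (tl hd : A → V) (s t : V) (u : A → ℝ) (x : List A → ℝ) : Prop :=
  ∀ b : A, ∃ y : List A → ℝ, IsStrictRerouting tl hd s t u x b y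

section Helpers
open Classical

lemma minimax_aux {ι J : Type} [Fintype J] (F : Finset ι) (M : J → ι → ℝ) (r : J → ℝ)
    (h : ∀ l : J → ℝ, (∀ j, 0 ≤ l j) → ∃ i ∈ F, ∑ j, l j * M j i ≤ ∑ j, l j * r j) :
    ∃ p : ι → ℝ, (∀ i, 0 ≤ p i) ∧ (∀ i, i ∉ F → p i = 0) ∧ ∑ i ∈ F, p i = 1 ∧
      ∀ j, ∑ i ∈ F, p i * M j i ≤ r j := by
  let L : (F → ℝ) →ₗ[ℝ] (J → ℝ) :=
    { toFun := fun p j => ∑ i : F, p i * M j i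
      map_add' := by
        intro p q; funext j; simp [add_mul, Finset.sum_add_distrib]
      map_smul' := by
        intro c p; funext j; simp [Finset.mul_sum, mul_assoc] }
  have hLc : Continuous L := L.continuous_of_finiteDimensional
  let K : Set (J → ℝ) := L '' (stdSimplex ℝ F)
  let C : Set (J → ℝ) := Set.Iic r
  by_cases hd : Disjoint K C
  · exfalso
    obtain ⟨f, u, v, hK, huv, hC⟩ := geometric_hahn_banach_compact_closed
      ((convex_stdSimplex ℝ F).linear_image L) ((isCompact_stdSimplex ℝ F).image hLc)
      (convex_Iic r) isClosed_Iic hd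
    have hf : ∀ z : J → ℝ, f z = ∑ j, z j * f (Pi.single j 1) := by
      intro z
      conv_lhs => rw [pi_eq_sum_univ' z]
      rw [map_sum]
      refine Finset.sum_congr rfl fun j _ => ?_
      rw [map_smul, smul_eq_mul]
    have hneg : ∀ j, f (Pi.single j 1) ≤ 0 := by
      intro j
      by_contra hpos
      push Not at hpos
      have h0 : v < f r := hC r (Set.mem_Iic.2 le_rfl)
      have hn : ∀ n : ℝ, 0 ≤ n → v < f r - n * f (Pi.single j 1) := by
        intro n hn
        have := hC (r - n • Pi.single j (1:ℝ)) (by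
          change _ ≤ r
          have : (0 : J → ℝ) ≤ n • Pi.single j (1:ℝ) :=
            smul_nonneg hn (by simp [Pi.single_nonneg])
          exact sub_le_self _ this)
        simpa using this
      have := hn ((f r - v) / f (Pi.single j 1)) (div_nonneg (by linarith) hpos.le)
      rw [div_mul_cancel₀ _ hpos.ne'] at this
      linarith
    obtain ⟨i, hi, hle⟩ := h (fun j => - f (Pi.single j 1)) (fun j => by linarith [hneg j])
    have h1 := hK (L (Pi.single ⟨i, hi⟩ 1)) ⟨_, single_mem_stdSimplex ℝ _, rfl⟩
    have h2 := hC r (Set.mem_Iic.2 le_rfl)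
    rw [hf] at h1 h2
    have h3 : ∀ j, L (Pi.single ⟨i, hi⟩ 1) j = M j i := by
      intro j
      change ∑ i' : F, (Pi.single (⟨i, hi⟩ : F) (1:ℝ) : F → ℝ) i' * M j i' = _
      rw [Finset.sum_eq_single ⟨i, hi⟩]
      · simp
      · intro b _ hb; simp [hb]
      · simp
    simp only [h3] at h1
    simp only [neg_mul, Finset.sum_neg_distrib] at hle
    simp only [mul_comm] at h1 h2 hle
    linarith
  · rw [Set.not_disjoint_iff] at hd
    obtain ⟨z, ⟨p, hp, rfl⟩, hz⟩ := hd
    have key : ∀ g : ι → ℝ, ∑ i ∈ F, (if h : i ∈ F then p ⟨i, h⟩ else 0) * g i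
        = ∑ i : F, p i * g i := by
      intro g
      rw [← Finset.sum_coe_sort F]
      refine Finset.sum_congr rfl fun i _ => ?_
      simp
    refine ⟨fun i => if h : i ∈ F then p ⟨i, h⟩ else 0, ?_, ?_, ?_, ?_⟩
    · intro i
      dsimp only
      split_ifs
      · exact hp.1 _
      · exact le_rfl
    · intro i hi; simp [hi]
    · have := key (fun _ => 1)
      simp only [mul_one] at this
      rw [this]; exact hp.2
    · intro j
      rw [key]
      exact hz j

lemma layer_aux {V A : Type} [Fintype A] (tl hd : A → V) (d : V → ℝ) (c β : A → ℝ) (γ k : ℝ)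
    (hγ : 0 ≤ γ) (hc : ∀ a, 0 ≤ c a) (hβ : ∀ a, 0 ≤ β a)
    (hdd : ∀ a, c a ≠ 0 → d (hd a) ≤ d (tl a) + β a)
    (hcut : ∀ θ, 0 ≤ θ → θ < γ →
      k ≤ ∑ a, if d (tl a) ≤ θ ∧ ¬ d (hd a) ≤ θ then c a else 0) :
    γ * k ≤ ∑ a, β a * c a := by
  have hI : ∀ a, (∫ θ in Set.Ico 0 γ, (Set.Ico (d (tl a)) (d (hd a))).indicator
      (fun _ => c a) θ) ≤ β a * c a := by
    intro a
    rw [MeasureTheory.setIntegral_indicator measurableSet_Ico, MeasureTheory.setIntegral_const,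
      smul_eq_mul]
    by_cases h0 : c a = 0
    · simp [h0]
    refine mul_le_mul_of_nonneg_right ?_ (hc a)
    have hdd := hdd a h0
    rw [Set.Ico_inter_Ico, MeasureTheory.measureReal_def, Real.volume_Ico]
    apply ENNReal.toReal_le_of_le_ofReal (hβ a)
    apply ENNReal.ofReal_le_ofReal
    have h1 : γ ⊓ d (hd a) ≤ d (hd a) := inf_le_right
    have h2 : d (tl a) ≤ 0 ⊔ d (tl a) := le_sup_right
    linarith
  have hint : ∀ a, MeasureTheory.IntegrableOn ((Set.Ico (d (tl a)) (d (hd a))).indicator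
      (fun _ => c a)) (Set.Ico 0 γ) := by
    intro a
    apply MeasureTheory.Integrable.indicator _ measurableSet_Ico
    exact MeasureTheory.integrableOn_const (by simp)
  calc γ * k = ∫ θ in Set.Ico 0 γ, k := by
        rw [MeasureTheory.setIntegral_const]; simp [hγ]
    _ ≤ ∫ θ in Set.Ico 0 γ, ∑ a, (Set.Ico (d (tl a)) (d (hd a))).indicator
      (fun _ => c a) θ := by
        apply MeasureTheory.setIntegral_mono_on
        · exact MeasureTheory.integrableOn_const (by simp)
        · exact MeasureTheory.integrable_finsetSum _ (fun a _ => hint a)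
        · exact measurableSet_Ico
        · intro θ hθ
          refine (hcut θ hθ.1 hθ.2).trans_eq (Finset.sum_congr rfl fun a _ => ?_)
          simp [Set.indicator_apply]
    _ = ∑ a, ∫ θ in Set.Ico 0 γ, (Set.Ico (d (tl a)) (d (hd a))).indicator
      (fun _ => c a) θ := MeasureTheory.integral_finsetSum _ (fun a _ => hint a)
    _ ≤ _ := Finset.sum_le_sum fun a _ => hI a

/-- every walk contains a path -/
lemma walk_suffix {V A : Type} {tl hd : A → V} : ∀ (L : List A) (v w : V), IsWalk tl hd v w L →
    ∀ z, z ∈ v :: L.map hd → ∃ L₂, IsWalk tl hd z w L₂ ∧ L₂ <:+ L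
  | [], v, w, h, z, hz => by
      simp at hz; subst hz; exact ⟨[], h, List.suffix_rfl⟩
  | a :: L, v, w, h, z, hz => by
      rcases List.mem_cons.1 hz with rfl | hz
      · exact ⟨a :: L, h, List.suffix_rfl⟩
      · obtain ⟨L₂, h1, h2⟩ := walk_suffix L (hd a) w h.2 z (by simpa using hz)
        exact ⟨L₂, h1, h2.trans (List.suffix_cons _ _)⟩

lemma walk_to_path {V A : Type} {tl hd : A → V} (n : ℕ) : ∀ (L : List A) (v w : V),
    L.length ≤ n → IsWalk tl hd v w L →
    ∃ P, IsPath tl hd v w P ∧ P.Sublist L := by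
  induction n with
  | zero =>
    intro L v w hn h
    have : L = [] := by simpa using hn
    subst this
    exact ⟨[], ⟨h, by simp⟩, List.Sublist.refl _⟩
  | succ n ih =>
    intro L v w hn h
    cases L with
    | nil => exact ⟨[], ⟨h, by simp⟩, List.Sublist.refl _⟩
    | cons a L =>
      by_cases hv : v ∈ hd a :: L.map hd
      · obtain ⟨L₂, h1, h2⟩ := walk_suffix L (hd a) w h.2 v hv
        obtain ⟨P, hP, hs⟩ := ih L₂ v w (by have := h2.length_le; simp at hn; omega) h1
        exact ⟨P, hP, hs.trans (h2.sublist.trans (List.sublist_cons_self _ _))⟩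
      · obtain ⟨P, hP, hs⟩ := ih L (hd a) w (by simpa using hn) h.2
        refine ⟨a :: P, ⟨⟨h.1, hP.1⟩, ?_⟩, hs.cons_cons a⟩
        have h2 := hP.2
        refine List.nodup_cons.2 ⟨fun hm => hv ?_, by simpa using h2⟩
        have : (hd a :: P.map hd).Sublist (hd a :: L.map hd) := (hs.map hd).cons_cons _
        exact this.subset (by simpa using hm)

lemma walk_snoc {V A : Type} {tl hd : A → V} (a : A) : ∀ (L : List A) (v : V),
    IsWalk tl hd v (tl a) L → IsWalk tl hd v (hd a) (L ++ [a])
  | [], v, h => ⟨h.symm, rfl⟩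
  | _ :: L, _, h => ⟨h.1, walk_snoc a L _ h.2⟩

lemma walk_cross {V A : Type} {tl hd : A → V} (U : Finset V) : ∀ (L : List A) (v w : V),
    IsWalk tl hd v w L → v ∈ U → w ∉ U → ∃ a ∈ L, tl a ∈ U ∧ hd a ∉ U
  | [], v, w, h, hv, hw => by cases h; exact absurd hv hw
  | a :: L, v, w, h, hv, hw => by
      by_cases ha : hd a ∈ U
      · obtain ⟨b, hb, h'⟩ := walk_cross U L _ w h.2 ha hw
        exact ⟨b, List.mem_cons_of_mem _ hb, h'⟩
      · exact ⟨a, by simp, by rw [h.1]; exact hv, ha⟩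

lemma walk_tail {V A : Type} {tl hd : A → V} (a : A) : ∀ (L : List A) (v w : V),
    IsWalk tl hd v w L → a ∈ L → ∃ L₂, IsWalk tl hd (tl a) w L₂ ∧ L₂ <:+ L
  | [], v, w, h, ha => by simp at ha
  | b :: L, v, w, h, ha => by
      rcases List.mem_cons.1 ha with rfl | ha
      · exact ⟨a :: L, ⟨rfl, h.2⟩, List.suffix_rfl⟩
      · obtain ⟨L₂, h1, h2⟩ := walk_tail a L (hd b) w h.2 ha
        exact ⟨L₂, h1, h2.trans (List.suffix_cons _ _)⟩

lemma dist_aux {V A : Type} (tl hd : A → V) (r t : V) (B : Set A) (ℓ : A → ℝ) (hℓ : ∀ a, 0 ≤ ℓ a)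
    (γ : ℝ) (hγ : 0 ≤ γ)
    (h : ∀ P, IsPath tl hd r t P → (∀ a ∈ P, a ∉ B) → γ ≤ (P.map ℓ).sum) :
    ∃ d : V → ℝ, d r = 0 ∧ γ ≤ d t ∧ ∀ a, a ∉ B → d (hd a) ≤ d (tl a) + ℓ a := by
  let S : V → Set ℝ := fun v =>
    insert γ {q | ∃ L, IsWalk tl hd r v L ∧ (∀ a ∈ L, a ∉ B) ∧ q = (L.map ℓ).sum}
  have hnn : ∀ L : List A, 0 ≤ (L.map ℓ).sum := fun L =>
    List.sum_nonneg (by intro q hq; obtain ⟨a, _, rfl⟩ := List.mem_map.1 hq; exact hℓ a)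
  have hS0 : ∀ v, ∀ q ∈ S v, 0 ≤ q := by
    rintro v q (rfl | ⟨L, _, _, rfl⟩)
    · exact hγ
    · exact hnn L
  have hbdd : ∀ v, BddBelow (S v) := fun v => ⟨0, fun q hq => hS0 v q hq⟩
  have hne : ∀ v, (S v).Nonempty := fun v => ⟨γ, Or.inl rfl⟩
  refine ⟨fun v => sInf (S v), ?_, ?_, ?_⟩
  · apply le_antisymm
    · exact csInf_le (hbdd r) (Or.inr ⟨[], rfl, by simp, by simp⟩)
    · exact le_csInf (hne r) (hS0 r)
  · apply le_csInf (hne t)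
    rintro q (rfl | ⟨L, hL, hB, rfl⟩)
    · exact le_rfl
    · obtain ⟨P, hP, hs⟩ := walk_to_path L.length L r t le_rfl hL
      refine (h P hP fun a ha => hB a (hs.subset ha)).trans ?_
      exact (hs.map ℓ).sum_le_sum (by
        intro q hq; obtain ⟨a, _, rfl⟩ := List.mem_map.1 hq; exact hℓ a)
  · intro a ha
    rw [← sub_le_iff_le_add]
    apply le_csInf (hne _)
    rintro q (rfl | ⟨L, hL, hB, rfl⟩)
    · have : sInf (S (hd a)) ≤ q := csInf_le (hbdd _) (Or.inl rfl)
      linarith [hℓ a]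
    · have : sInf (S (hd a)) ≤ ((L ++ [a]).map ℓ).sum := csInf_le (hbdd _)
        (Or.inr ⟨L ++ [a], walk_snoc a L r hL, by
          intro e he
          rcases List.mem_append.1 he with he | he
          · exact hB e he
          · simp at he; subst he; exact ha, rfl⟩)
      simp at this
      linarith

lemma finite_nodup (A : Type) [Fintype A] : {L : List A | L.Nodup}.Finite :=
  (List.finite_length_le A (Fintype.card A)).subset fun _ hL => List.Nodup.length_le_card hL

noncomputable def nodupLists (A : Type) [Fintype A] : Finset (List A) :=
  (finite_nodup A).toFinset

lemma mem_nodupLists {A : Type} [Fintype A] {L : List A} : L ∈ nodupLists A ↔ L.Nodup := by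
  simp [nodupLists]

lemma path_nodup {V A : Type} {tl hd : A → V} {v w : V} {L : List A}
    (h : IsPath tl hd v w L) : L.Nodup :=
  List.Nodup.of_map hd (List.nodup_cons.1 h.2).2

lemma sumOver_eq {A : Type} [Fintype A] (x : List A → ℝ) (S : Set (List A))
    (hS : ∀ P ∈ S, P.Nodup) :
    sumOver x S = ∑ P ∈ nodupLists A, if P ∈ S then x P else 0 := by
  have hf : S.Finite := (finite_nodup A).subset hS
  unfold sumOver
  rw [finsum_mem_eq_finite_toFinset_sum _ hf, ← Finset.sum_filter]
  refine Finset.sum_congr ?_ fun _ _ => rfl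
  ext P
  simp only [Set.Finite.mem_toFinset, Finset.mem_filter, mem_nodupLists]
  exact ⟨fun h => ⟨hS P h, h⟩, fun h => h.2⟩

lemma list_sum_eq {A : Type} [Fintype A] (f : A → ℝ) (L : List A) (hL : L.Nodup) :
    (L.map f).sum = ∑ a, if a ∈ L then f a else 0 := by
  rw [← List.sum_toFinset f hL, ← Finset.sum_filter]
  refine Finset.sum_congr ?_ fun _ _ => rfl
  ext a; simp

lemma exists_gap {ι : Type} (F : Finset ι) (f : ι → ℝ) (γ : ℝ) (h : ∀ i ∈ F, γ < f i) :
    ∃ γ', γ < γ' ∧ ∀ i ∈ F, γ' ≤ f i := by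
  by_cases hF : F.Nonempty
  · obtain ⟨i, hi, hm⟩ := F.exists_min_image f hF
    exact ⟨f i, h i hi, hm⟩
  · rw [Finset.not_nonempty_iff_eq_empty] at hF
    subst hF
    exact ⟨γ + 1, by linarith, by simp⟩

lemma mfmc_aux {V A : Type} [Fintype V] [Fintype A] (tl hd : A → V) (r t : V) (b : A)
    (c : A → ℝ) (hc : ∀ a, 0 ≤ c a) (hcb : c b = 0) (k : ℝ) (hk : 0 ≤ k)
    (hcut : ∀ U : Finset V, r ∈ U → t ∉ U →
      k ≤ ∑ a, if tl a ∈ U ∧ hd a ∉ U then c a else 0) :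
    ∃ y : List A → ℝ, (∀ Q, 0 ≤ y Q) ∧ (∀ Q, ¬ (IsPath tl hd r t Q ∧ b ∉ Q) → y Q = 0) ∧
      (∑ Q ∈ nodupLists A, y Q = k) ∧
      ∀ a, (∑ Q ∈ nodupLists A, if a ∈ Q then y Q else 0) ≤ c a := by
  rcases hk.eq_or_lt with rfl | hk
  · exact ⟨fun _ => 0, by simp, by simp, by simp, by simpa using hc⟩
  let F : Finset (List A) := (nodupLists A).filter (fun Q => IsPath tl hd r t Q ∧ b ∉ Q)
  have hFm : ∀ Q, Q ∈ F ↔ IsPath tl hd r t Q ∧ b ∉ Q := by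
    intro Q
    simp only [F, Finset.mem_filter, mem_nodupLists]
    exact ⟨fun h => h.2, fun h => ⟨path_nodup h.1, h⟩⟩
  obtain ⟨p, hp0, hpF, hp1, hpc⟩ := minimax_aux F (fun a Q => if a ∈ Q then k else 0) c (by
    intro β hβ
    by_contra hcon
    push Not at hcon
    obtain ⟨γ, hγ1, hγ2⟩ := exists_gap F (fun Q => (Q.map β).sum) ((∑ a, β a * c a) / k) (by
      intro Q hQ
      rw [div_lt_iff₀ hk]
      refine (hcon Q hQ).trans_eq ?_
      rw [list_sum_eq _ _ (path_nodup ((hFm Q).1 hQ).1), Finset.sum_mul]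
      refine Finset.sum_congr rfl fun a _ => ?_
      split_ifs <;> simp)
    rw [div_lt_iff₀ hk] at hγ1
    have hR : 0 ≤ ∑ a, β a * c a := Finset.sum_nonneg fun a _ => mul_nonneg (hβ a) (hc a)
    have hγ0 : 0 ≤ γ := by
      by_contra h
      push Not at h
      nlinarith
    obtain ⟨d, hd0, hdt, hda⟩ := dist_aux tl hd r t {b} β hβ γ hγ0 (by
      intro P hP hB
      exact hγ2 P ((hFm P).2 ⟨hP, fun h => hB b h rfl⟩))
    have := layer_aux tl hd d c β γ k hγ0 hc hβ (by
      intro a ha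
      apply hda
      rintro rfl
      exact ha hcb) (by
      intro θ h0 h1
      have := hcut (Finset.univ.filter fun v => d v ≤ θ) (by simp [hd0, h0])
        (by simp; linarith)
      simpa using this)
    linarith)
  have hsub : F ⊆ nodupLists A := Finset.filter_subset _ _
  refine ⟨fun Q => k * p Q, fun Q => mul_nonneg hk.le (hp0 Q), ?_, ?_, ?_⟩
  · intro Q hQ
    simp [hpF Q (fun h => hQ ((hFm Q).1 h))]
  · rw [← Finset.mul_sum, ← Finset.sum_subset hsub (fun Q _ h => hpF Q h), hp1, mul_one]
  · intro a
    refine le_of_eq_of_le ?_ (hpc a)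
    rw [← Finset.sum_subset hsub (fun Q _ h => by simp [hpF Q h])]
    refine Finset.sum_congr rfl fun Q _ => ?_
    split_ifs <;> simp [mul_comm]

lemma before_mem {A : Type} {pre L : List A} {a b : A} (hn : (pre ++ a :: L).Nodup)
    (h : Before (pre ++ a :: L) b a) : b ∈ pre := by
  obtain ⟨l₁, l₂, l₃, h⟩ := h
  have h' : pre ++ a :: L = (l₁ ++ b :: l₂) ++ a :: l₃ := by rw [h]; simp
  have hn2 : ((l₁ ++ b :: l₂) ++ a :: l₃).Nodup := h' ▸ hn
  have ha1 : a ∉ pre := fun hm => (List.nodup_append.1 hn).2.2 a hm a (by simp) rfl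
  have ha2 : a ∉ l₁ ++ b :: l₂ := fun hm => (List.nodup_append.1 hn2).2.2 a hm a (by simp) rfl
  have : pre = l₁ ++ b :: l₂ := by
    have e1 := congrArg (List.takeWhile (fun z => decide (z ≠ a))) h'
    rw [List.takeWhile_append_of_pos, List.takeWhile_append_of_pos] at e1
    · simpa using e1
    · intro z hz; simp; rintro rfl; exact ha2 hz
    · intro z hz; simp; rintro rfl; exact ha1 hz
  rw [this]; simp

lemma not_before_self {A : Type} {P : List A} (hn : P.Nodup) (b : A) : ¬ Before P b b := by
  rintro ⟨l₁, l₂, l₃, rfl⟩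
  have := (List.nodup_append.1 hn).2.1
  simp at this

/-- the key potential argument along one path -/
lemma key_path {V A J : Type} [Fintype J] (tl hd : A → V) (t : V) (π : V → ℝ)
    (α : A → ℝ) (hα : ∀ a, 0 ≤ α a) (l : J → ℝ) (hl : ∀ j, 0 ≤ l j)
    (D : J → A → Prop) (m : J → A)
    (hm : ∀ j a, D j a → π (hd a) ≤ π (hd (m j)))
    (hπ : ∀ a, π (hd a) ≤ π (tl a) + (α a + ∑ j, if D j a then l j else 0))
    (P : List A) (hP : P.Nodup) :
    ∀ (suf pre : List A) (v : V) (G : ℝ), P = pre ++ suf → IsWalk tl hd v t suf → π v ≤ G →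
      (∀ j, m j ∈ pre → π (hd (m j)) ≤ G) →
      π t ≤ G + (suf.map fun a => α a + ∑ j, if D j a ∧ ¬ Before P (m j) a then l j else 0).sum
  | [], pre, v, G, _, hw, hv, _ => by
      cases hw; simpa using hv
  | a :: L, pre, v, G, hPe, hw, hv, hact => by
      rw [List.map_cons, List.sum_cons, ← add_assoc]
      have hnn : 0 ≤ α a + ∑ j, if D j a ∧ ¬ Before P (m j) a then l j else 0 :=
        add_nonneg (hα a) (Finset.sum_nonneg fun j _ => by split_ifs; exacts [hl j, le_rfl])
      have hv' : π (hd a) ≤ G + (α a + ∑ j, if D j a ∧ ¬ Before P (m j) a then l j else 0) := by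
        by_cases h : ∃ j, D j a ∧ Before P (m j) a
        · obtain ⟨j, hj, hb⟩ := h
          have : m j ∈ pre := by
            rw [hPe] at hb hP
            exact before_mem hP hb
          linarith [hm j a hj, hact j this]
        · push Not at h
          have e : (∑ j, if D j a ∧ ¬ Before P (m j) a then l j else 0)
              = ∑ j, if D j a then l j else 0 := by
            refine Finset.sum_congr rfl fun j _ => ?_
            by_cases hj : D j a
            · simp [hj, h j hj]
            · simp [hj]
          rw [e]
          have := hπ a
          rw [hw.1] at this
          linarith
      refine key_path tl hd t π α hα l hl D m hm hπ P hP L (pre ++ [a]) (hd a) _ (by simp [hPe])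
        hw.2 hv' ?_
      intro j hj
      rcases List.mem_append.1 hj with hj | hj
      · linarith [hact j hj]
      · have : m j = a := by simpa using hj
        rw [this]; exact hv'

lemma sumOver_cross {A : Type} [Fintype A] (y : List A → ℝ) (hy : ∀ Q, 0 ≤ y Q)
    (S : Set (List A)) (hS : ∀ P ∈ S, P.Nodup) (E : A → Prop)
    (h : ∀ Q ∈ S, ∃ a ∈ Q, E a) :
    sumOver y S ≤ ∑ a, if E a then sumOver y {Q | Q ∈ S ∧ a ∈ Q} else 0 := by
  have e : ∀ a, (if E a then sumOver y {Q | Q ∈ S ∧ a ∈ Q} else 0)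
      = ∑ Q ∈ nodupLists A, if E a ∧ Q ∈ S ∧ a ∈ Q then y Q else 0 := by
    intro a
    rw [sumOver_eq y _ (fun P hP => hS P hP.1)]
    by_cases ha : E a
    · rw [if_pos ha]
      refine Finset.sum_congr rfl fun Q _ => ?_
      by_cases hQ : Q ∈ S ∧ a ∈ Q
      · exact (if_pos hQ).trans (if_pos ⟨ha, hQ⟩).symm
      · exact (if_neg hQ).trans (if_neg (fun h => hQ h.2)).symm
    · simp [ha]
  simp only [e]
  rw [sumOver_eq y S hS, Finset.sum_comm]
  refine Finset.sum_le_sum fun Q _ => ?_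
  split_ifs with hQ
  · obtain ⟨a, ha, hE⟩ := h Q hQ
    refine le_trans ?_ (Finset.single_le_sum (f := fun a => if E a ∧ Q ∈ S ∧ a ∈ Q then y Q else 0)
      (fun a _ => ?_) (Finset.mem_univ a))
    · simp [ha, hE, hQ]
    · split_ifs
      exacts [hy Q, le_rfl]
  · refine Finset.sum_nonneg fun a _ => ?_
    split_ifs
    exacts [hy Q, le_rfl]

lemma sumOver_mono {A : Type} [Fintype A] (y : List A → ℝ) (hy : ∀ Q, 0 ≤ y Q)
    (S T : Set (List A)) (hT : ∀ P ∈ T, P.Nodup) (h : S ⊆ T) : sumOver y S ≤ sumOver y T := by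
  rw [sumOver_eq y S (fun P hP => hT P (h hP)), sumOver_eq y T hT]
  refine Finset.sum_le_sum fun Q _ => ?_
  by_cases hQ : Q ∈ S
  · simp [hQ, h hQ]
  · simp only [hQ, if_false]
    split_ifs
    exacts [hy Q, le_rfl]

lemma sumOver_path {V A : Type} [Fintype A] (tl hd : A → V) (s t : V) (x : List A → ℝ)
    (h0 : ∀ P, ¬ IsPath tl hd s t P → x P = 0) (q : List A → Prop) :
    sumOver x {P | IsPath tl hd s t P ∧ q P} = ∑ P ∈ nodupLists A, if q P then x P else 0 := by
  rw [sumOver_eq x _ (fun P hP => path_nodup hP.1)]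
  refine Finset.sum_congr rfl fun P _ => ?_
  by_cases hP : IsPath tl hd s t P
  · simp [hP]
  · simp [hP, h0 P hP]

lemma flowVal_eq {V A : Type} [Fintype A] (tl hd : A → V) (s t : V) (x : List A → ℝ)
    (h0 : ∀ P, ¬ IsPath tl hd s t P → x P = 0) :
    flowVal tl hd s t x = ∑ P ∈ nodupLists A, x P := by
  have := sumOver_path tl hd s t x h0 (fun _ => True)
  simpa [flowVal] using this

lemma cut_of_rerouting {V A : Type} [Fintype A] (tl hd : A → V) (s t : V) (x : List A → ℝ)
    (b : A) (y : List A → ℝ) (hy : IsRerouting tl hd s t (fun _ => (1:ℝ)) x b y)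
    (U : Finset V) (ht : t ∉ U) (hb1 : tl b ∈ U) (hb2 : hd b ∉ U) :
    (∑ a, if tl a ∈ U ∧ hd a ∉ U then
      sumOver x {P | IsPath tl hd s t P ∧ a ∈ P ∧ ¬ Before P b a} else 0)
      ≤ (∑ a, if tl a ∈ U ∧ hd a ∉ U then (1:ℝ) else 0) - 1 := by
  obtain ⟨hy0, _, hyc, hyv⟩ := hy
  have hbb : sumOver x {P | IsPath tl hd s t P ∧ b ∈ P ∧ ¬ Before P b b}
      = arcFlow tl hd s t x b := by
    unfold arcFlow
    congr 1
    ext P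
    simp only [Set.mem_setOf_eq]
    exact ⟨fun h => ⟨h.1, h.2.1⟩, fun h => ⟨h.1, h.2, not_before_self (path_nodup h.1) b⟩⟩
  have h1 := sumOver_cross y hy0 {Q | IsPath tl hd (tl b) t Q ∧ b ∉ Q}
    (fun P hP => path_nodup hP.1) (fun a => (tl a ∈ U ∧ hd a ∉ U) ∧ a ≠ b) (by
      intro Q hQ
      obtain ⟨a, ha, h⟩ := walk_cross U Q _ _ hQ.1.1 hb1 ht
      exact ⟨a, ha, h, fun e => hQ.2 (e ▸ ha)⟩)
  have h2 : sumOver y {Q | IsPath tl hd (tl b) t Q ∧ b ∉ Q} = arcFlow tl hd s t x b := hyv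
  rw [h2, ← hbb] at h1
  have h3 : ∀ a, (if (tl a ∈ U ∧ hd a ∉ U) ∧ a ≠ b then
      sumOver y {Q | Q ∈ {Q | IsPath tl hd (tl b) t Q ∧ b ∉ Q} ∧ a ∈ Q} else 0)
      ≤ (if tl a ∈ U ∧ hd a ∉ U then (1:ℝ) else 0) - (if tl a ∈ U ∧ hd a ∉ U then
      sumOver x {P | IsPath tl hd s t P ∧ a ∈ P ∧ ¬ Before P b a} else 0)
      - (if a = b then 1 - sumOver x {P | IsPath tl hd s t P ∧ b ∈ P ∧ ¬ Before P b b} else 0) := by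
    intro a
    by_cases hab : a = b
    · subst hab
      simp [hb1, hb2]
    · by_cases hU : tl a ∈ U ∧ hd a ∉ U
      · have := hyc a hab
        simp only [reArcFlow, availCap] at this
        rw [if_pos ⟨hU, hab⟩, if_pos hU, if_pos hU, if_neg hab, sub_zero]
        refine le_trans (le_of_eq ?_) this
        congr 1
        ext Q
        exact and_assoc
      · rw [if_neg (fun h => hU h.1), if_neg hU, if_neg hU, if_neg hab]
        simp
  have h4 := Finset.sum_le_sum (s := Finset.univ) fun a _ => h3 a
  rw [Finset.sum_sub_distrib, Finset.sum_sub_distrib, Finset.sum_ite_eq' Finset.univ b] at h4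
  simp only [Finset.mem_univ, if_true] at h4
  have h5 := h1.trans (le_trans (le_of_eq (by congr!)) h4)
  linarith

lemma exists_cutflow {V A : Type} [Fintype V] [Fintype A] (tl hd : A → V) (s t : V)
    (x : List A → ℝ) (hx0 : ∀ P, 0 ≤ x P) (hxp : ∀ P, ¬ IsPath tl hd s t P → x P = 0)
    (hval : 0 < flowVal tl hd s t x)
    (hcut : ∀ (U : Finset V) (b : A), t ∉ U → tl b ∈ U → hd b ∉ U →
      (∑ a, if tl a ∈ U ∧ hd a ∉ U then
      sumOver x {P | IsPath tl hd s t P ∧ a ∈ P ∧ ¬ Before P b a} else 0)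
      ≤ (∑ a, if tl a ∈ U ∧ hd a ∉ U then (1:ℝ) else 0) - 1) :
    ∃ x' : List A → ℝ, (∀ P, 0 ≤ x' P) ∧ (∀ P, ¬ IsPath tl hd s t P → x' P = 0) ∧
      flowVal tl hd s t x' = flowVal tl hd s t x ∧
      (∀ a, arcFlow tl hd s t x' a ≤ arcFlow tl hd s t x a) ∧
      ∀ U : Finset V, t ∉ U → (∃ a, tl a ∈ U ∧ hd a ∉ U) →
        (∑ a, if tl a ∈ U ∧ hd a ∉ U then arcFlow tl hd s t x' a else 0)
          ≤ (∑ a, if tl a ∈ U ∧ hd a ∉ U then (1:ℝ) else 0) - 1 := by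
  set k := flowVal tl hd s t x with hkdef
  let F : Finset (List A) := (nodupLists A).filter (fun Q => IsPath tl hd s t Q)
  have hFm : ∀ Q, Q ∈ F ↔ IsPath tl hd s t Q := by
    intro Q
    simp only [F, Finset.mem_filter, mem_nodupLists]
    exact ⟨fun h => h.2, fun h => ⟨path_nodup h, h⟩⟩
  have hFne : F.Nonempty := by
    by_contra h
    rw [Finset.not_nonempty_iff_eq_empty] at h
    have : k = 0 := by
      rw [hkdef, flowVal_eq tl hd s t x hxp]
      refine Finset.sum_eq_zero fun P _ => hxp P fun hP => ?_
      have := (hFm P).2 hP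
      simp [h] at this
    linarith
  let J := {U : Finset V // t ∉ U ∧ ∃ a, tl a ∈ U ∧ hd a ∉ U}
  let D : J → A → Prop := fun U a => tl a ∈ U.1 ∧ hd a ∉ U.1
  obtain ⟨p, hp0, hpF, hp1, hpc⟩ := minimax_aux (J := A ⊕ J) F
    (fun j P => k * Sum.elim (fun a => if a ∈ P then (1:ℝ) else 0)
      (fun U => ∑ a, if D U a ∧ a ∈ P then (1:ℝ) else 0) j)
    (Sum.elim (fun a => arcFlow tl hd s t x a)
      (fun U => (∑ a, if D U a then (1:ℝ) else 0) - 1)) (by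
    intro l hl
    let α : A → ℝ := fun a => l (Sum.inl a)
    let lam : J → ℝ := fun U => l (Sum.inr U)
    let ℓ : A → ℝ := fun a => α a + ∑ j, if D j a then lam j else 0
    have hℓ : ∀ a, 0 ≤ ℓ a := fun a => add_nonneg (hl _)
      (Finset.sum_nonneg fun j _ => by split_ifs; exacts [hl _, le_rfl])
    obtain ⟨P0, hP0, hmin⟩ := F.exists_min_image (fun P => (P.map ℓ).sum) hFne
    refine ⟨P0, hP0, ?_⟩
    have hγ0 : 0 ≤ (P0.map ℓ).sum := List.sum_nonneg (by
      intro q hq; obtain ⟨a, _, rfl⟩ := List.mem_map.1 hq; exact hℓ a)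
    obtain ⟨π, hπ0, hπt, hπ⟩ := dist_aux tl hd s t ∅ ℓ hℓ _ hγ0 (fun P hP _ =>
      hmin P ((hFm P).2 hP))
    have hm : ∀ j : J, ∃ b, D j b ∧ ∀ a, D j a → π (hd a) ≤ π (hd b) := by
      intro j
      obtain ⟨b, hb, hb2⟩ := (Finset.univ.filter (D j)).exists_max_image (fun a => π (hd a)) (by
        obtain ⟨a, ha⟩ := j.2.2
        exact ⟨a, by simp only [Finset.mem_filter, Finset.mem_univ, true_and]; exact ha⟩)
      simp only [Finset.mem_filter, Finset.mem_univ, true_and] at hb hb2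
      exact ⟨b, hb, hb2⟩
    choose m hmD hmax using hm
    have hpath : ∀ P, IsPath tl hd s t P → (P0.map ℓ).sum ≤
        ∑ a, if a ∈ P then α a + ∑ j, (if D j a ∧ ¬ Before P (m j) a then lam j else 0) else 0 := by
      intro P hP
      have := key_path tl hd t π α (fun a => hl _) lam (fun j => hl _) D m hmax
        (fun a => (hπ a (by simp)).trans (le_of_eq (by simp only [ℓ]; congr!))) P (path_nodup hP) P [] s 0 (by simp) hP.1 hπ0.le (by simp)
      rw [list_sum_eq _ _ (path_nodup hP)] at this
      rw [zero_add] at this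
      exact hπt.trans (this.trans (le_of_eq (by congr!)))
    have e1 : ∑ j, l j * (k * Sum.elim (fun a => if a ∈ P0 then (1:ℝ) else 0)
      (fun U => ∑ a, if D U a ∧ a ∈ P0 then (1:ℝ) else 0) j) = k * (P0.map ℓ).sum := by
      rw [list_sum_eq _ _ (path_nodup ((hFm P0).1 hP0)), Fintype.sum_sum_type, Finset.mul_sum]
      simp only [Sum.elim_inl, Sum.elim_inr, Finset.mul_sum]
      rw [Finset.sum_comm (s := (Finset.univ : Finset J)), ← Finset.sum_add_distrib]
      refine Finset.sum_congr rfl fun a _ => ?_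
      by_cases ha : a ∈ P0
      · simp only [ha, if_true, and_true, ℓ, mul_add, Finset.mul_sum]
        congr 1
        · simp only [α]; ring
        · refine Finset.sum_congr rfl fun j _ => ?_
          split_ifs
          · simp only [lam]; ring
          · simp
      · simp [ha]
    rw [e1]
    have e2 : k * (P0.map ℓ).sum ≤ ∑ P ∈ nodupLists A, x P *
        ∑ a, if a ∈ P then α a + ∑ j, (if D j a ∧ ¬ Before P (m j) a then lam j else 0) else 0 := by
      rw [hkdef, flowVal_eq tl hd s t x hxp, Finset.sum_mul]
      refine Finset.sum_le_sum fun P _ => ?_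
      by_cases hP : IsPath tl hd s t P
      · exact mul_le_mul_of_nonneg_left (hpath P hP) (hx0 P)
      · simp [hxp P hP]
    refine e2.trans ?_
    have e3 : ∑ P ∈ nodupLists A, x P *
        (∑ a, if a ∈ P then α a + ∑ j, (if D j a ∧ ¬ Before P (m j) a then lam j else 0) else 0)
        = (∑ a, α a * arcFlow tl hd s t x a) + ∑ j, lam j * ∑ a, if D j a then
          sumOver x {P | IsPath tl hd s t P ∧ a ∈ P ∧ ¬ Before P (m j) a} else 0 := by
      have f1 : ∀ P, x P *
        (∑ a, if a ∈ P then α a + ∑ j, (if D j a ∧ ¬ Before P (m j) a then lam j else 0) else 0)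
        = (∑ a, α a * (if a ∈ P then x P else 0)) + ∑ j, ∑ a, lam j *
          (if D j a then (if a ∈ P ∧ ¬ Before P (m j) a then x P else 0) else 0) := by
        intro P
        rw [Finset.sum_comm (s := (Finset.univ : Finset J)), ← Finset.sum_add_distrib,
          Finset.mul_sum]
        refine Finset.sum_congr rfl fun a _ => ?_
        by_cases ha : a ∈ P
        · simp only [ha, if_true, true_and, mul_add, Finset.mul_sum]
          congr 1
          · ring
          · refine Finset.sum_congr rfl fun j _ => ?_
            by_cases h1 : D j a <;> by_cases h2 : Before P (m j) a <;> simp [h1, h2, mul_comm]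
        · simp [ha]
      simp only [f1]
      rw [Finset.sum_add_distrib]
      congr 1
      · rw [Finset.sum_comm]
        refine Finset.sum_congr rfl fun a _ => ?_
        rw [← Finset.mul_sum, arcFlow, sumOver_path tl hd s t x hxp]
        congr!
      · rw [Finset.sum_comm]
        refine Finset.sum_congr rfl fun j _ => ?_
        rw [Finset.sum_comm, Finset.mul_sum]
        refine Finset.sum_congr rfl fun a _ => ?_
        rw [← Finset.mul_sum]
        congr 1
        by_cases h1 : D j a
        · simp only [h1, if_true]
          rw [sumOver_path tl hd s t x hxp]
          congr!
        · simp [h1]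
    rw [e3, Fintype.sum_sum_type]
    simp only [Sum.elim_inl, Sum.elim_inr]
    refine add_le_add le_rfl (Finset.sum_le_sum fun j _ => ?_)
    exact mul_le_mul_of_nonneg_left (hcut j.1 (m j) j.2.1 (hmD j).1 (hmD j).2) (hl _))
  have hsub : F ⊆ nodupLists A := Finset.filter_subset _ _
  have hxp' : ∀ P, ¬ IsPath tl hd s t P → k * p P = 0 := by
    intro Q hQ
    simp [hpF Q (fun h => hQ ((hFm Q).1 h))]
  have harc : ∀ a, arcFlow tl hd s t (fun P => k * p P) a
      = ∑ P ∈ F, p P * (k * if a ∈ P then (1:ℝ) else 0) := by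
    intro a
    rw [arcFlow, sumOver_path tl hd s t _ hxp',
      ← Finset.sum_subset hsub (fun Q _ h => by simp [hpF Q h])]
    refine Finset.sum_congr rfl fun P _ => ?_
    split_ifs <;> simp [mul_comm]
  refine ⟨fun P => k * p P, fun P => mul_nonneg hval.le (hp0 P), hxp', ?_, ?_, ?_⟩
  · rw [flowVal_eq tl hd s t _ hxp', ← Finset.mul_sum,
      ← Finset.sum_subset hsub (fun Q _ h => hpF Q h), hp1, mul_one]
  · intro a
    rw [harc]
    exact hpc (Sum.inl a)
  · intro U hU hne
    refine le_of_eq_of_le ?_ (hpc (Sum.inr ⟨U, hU, hne⟩))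
    simp only [Sum.elim_inr, harc, Finset.mul_sum]
    rw [Finset.sum_comm]
    refine Finset.sum_congr rfl fun a _ => ?_
    by_cases h : tl a ∈ U ∧ hd a ∉ U
    · simp [D, h]
    · simp only [D, h, if_false, false_and, mul_zero, Finset.sum_const_zero]

lemma strict_of_cut {V A : Type} [Fintype V] [Fintype A] (tl hd : A → V) (s t : V)
    (x : List A → ℝ) (hx0 : ∀ P, 0 ≤ x P) (hx1 : ∀ a, arcFlow tl hd s t x a ≤ 1)
    (hcut : ∀ U : Finset V, t ∉ U → (∃ a, tl a ∈ U ∧ hd a ∉ U) →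
        (∑ a, if tl a ∈ U ∧ hd a ∉ U then arcFlow tl hd s t x a else 0)
          ≤ (∑ a, if tl a ∈ U ∧ hd a ∉ U then (1:ℝ) else 0) - 1) :
    StrictlyReroutable tl hd s t (fun _ => (1:ℝ)) x := by
  intro b
  have hb0 : 0 ≤ arcFlow tl hd s t x b := by
    rw [arcFlow, sumOver_eq x _ (fun P hP => path_nodup hP.1)]
    exact Finset.sum_nonneg fun P _ => by split_ifs; exacts [hx0 P, le_rfl]
  obtain ⟨y, hy0, hyp, hyv, hyc⟩ := mfmc_aux tl hd (tl b) t b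
    (fun a => if a = b then 0 else 1 - arcFlow tl hd s t x a)
    (fun a => by split_ifs; exacts [le_rfl, sub_nonneg.2 (hx1 a)]) (by simp)
    (arcFlow tl hd s t x b) hb0 (by
      intro U hbU htU
      by_cases hne : ∃ a, tl a ∈ U ∧ hd a ∉ U
      · have h := hcut U htU hne
        have e : (∑ a, if tl a ∈ U ∧ hd a ∉ U then
            (if a = b then 0 else 1 - arcFlow tl hd s t x a) else 0)
            = (∑ a, if tl a ∈ U ∧ hd a ∉ U then (1:ℝ) else 0)
              - (∑ a, if tl a ∈ U ∧ hd a ∉ U then arcFlow tl hd s t x a else 0)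
              - if hd b ∉ U then 1 - arcFlow tl hd s t x b else 0 := by
          have : (if hd b ∉ U then 1 - arcFlow tl hd s t x b else 0)
            = ∑ a, if a = b then (if hd b ∉ U then 1 - arcFlow tl hd s t x b else 0) else 0 := by
            simp
          rw [this, ← Finset.sum_sub_distrib, ← Finset.sum_sub_distrib]
          refine Finset.sum_congr rfl fun a _ => ?_
          by_cases hab : a = b
          · subst hab
            by_cases h2 : hd a ∈ U <;> simp [hbU, h2]
          · by_cases h2 : tl a ∈ U ∧ hd a ∉ U
            · simp [hab, h2]
            · simp only [hab, h2, if_false]; simp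
        rw [e]
        have := hx1 b
        split_ifs <;> linarith
      · have h1 := sumOver_cross x hx0 {P | IsPath tl hd s t P ∧ b ∈ P}
          (fun P hP => path_nodup hP.1) (fun a => tl a ∈ U ∧ hd a ∉ U) (by
            intro Q hQ
            obtain ⟨L, hL, hs⟩ := walk_tail b Q _ _ hQ.1.1 hQ.2
            obtain ⟨a, ha, h⟩ := walk_cross U L _ _ hL hbU htU
            exact ⟨a, hs.subset ha, h⟩)
        push Not at hne
        have hne' : ∀ a, ¬ (tl a ∈ U ∧ hd a ∉ U) := fun a h => h.2 (hne a h.1)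
        simp only [hne', if_false, Finset.sum_const_zero] at h1 ⊢
        exact h1)
  refine ⟨y, hy0, hyp, ?_, ?_⟩
  · intro a hab
    have := hyc a
    rw [if_neg hab] at this
    refine le_trans (le_of_eq ?_) this
    unfold reArcFlow
    rw [sumOver_eq y _ (fun P hP => path_nodup hP.1)]
    refine Finset.sum_congr rfl fun Q _ => ?_
    by_cases hQ : IsPath tl hd (tl b) t Q ∧ b ∉ Q
    · simp [hQ]
    · simp [hyp Q hQ]
  · rw [← hyv]
    unfold reVal
    rw [sumOver_eq y _ (fun P hP => path_nodup hP.1)]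
    refine Finset.sum_congr rfl fun Q _ => ?_
    by_cases hQ : IsPath tl hd (tl b) t Q ∧ b ∉ Q
    · simp [hQ]
    · simp [hyp Q hQ]

lemma main_aux {V A : Type} [Fintype V] [Fintype A]
    (tl hd : A → V) (s t : V)
    (x : List A → ℝ) (hx : IsFlow tl hd s t (fun _ => (1 : ℝ)) x)
    (hrf : Reroutable tl hd s t (fun _ => (1 : ℝ)) x) :
    ∃ x' : List A → ℝ,
      IsFlow tl hd s t (fun _ => (1 : ℝ)) x' ∧
      StrictlyReroutable tl hd s t (fun _ => (1 : ℝ)) x' ∧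
      flowVal tl hd s t x' = flowVal tl hd s t x ∧
      ∀ a : A, arcFlow tl hd s t x' a ≤ arcFlow tl hd s t x a := by
  obtain ⟨hx0, hxp, hxc⟩ := hx
  have hv : 0 ≤ flowVal tl hd s t x := by
    rw [flowVal_eq tl hd s t x hxp]
    exact Finset.sum_nonneg fun P _ => hx0 P
  rcases hv.eq_or_lt with hv | hv
  · have ha : ∀ a, arcFlow tl hd s t (fun _ => 0) a = 0 := by
      intro a; simp [arcFlow, sumOver]
    refine ⟨fun _ => 0, ⟨by simp, by simp, by simp [ha]⟩, ?_, ?_, ?_⟩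
    · intro b
      refine ⟨fun _ => 0, by simp, by simp, ?_, ?_⟩
      · intro a _
        rw [ha]; simp [reArcFlow, sumOver]
      · rw [ha]; simp [reVal, sumOver]
    · rw [← hv]; simp [flowVal, sumOver]
    · intro a
      rw [ha, arcFlow, sumOver_eq x _ (fun P hP => path_nodup hP.1)]
      exact Finset.sum_nonneg fun P _ => by split_ifs; exacts [hx0 P, le_rfl]
  · obtain ⟨x', h0, hp, hval, harc, hcut⟩ := exists_cutflow tl hd s t x hx0 hxp hv (by
      intro U b ht h1 h2
      obtain ⟨y, hy⟩ := hrf b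
      exact cut_of_rerouting tl hd s t x b y hy U ht h1 h2)
    have h1 : ∀ a, arcFlow tl hd s t x' a ≤ 1 := fun a => (harc a).trans (hxc a)
    exact ⟨x', ⟨h0, hp, h1⟩, strict_of_cut tl hd s t x' h0 h1 hcut, hval, harc⟩

end Helpers

/-- In a unit-capacity network, for every reroutable s-t-flow `x` there is a
strictly reroutable s-t-flow `x'` with the same value and `x'(a) ≤ x(a)` on every arc. -/
theorem unit_reroutable_to_strictlyReroutable
    {V A : Type} [Fintype V] [DecidableEq V] [Fintype A] [DecidableEq A]
    (tl hd : A → V) (s t : V)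
    (x : List A → ℝ) (hx : IsFlow tl hd s t (fun _ => (1 : ℝ)) x)
    (hrf : Reroutable tl hd s t (fun _ => (1 : ℝ)) x) :
    ∃ x' : List A → ℝ,
      IsFlow tl hd s t (fun _ => (1 : ℝ)) x' ∧
      StrictlyReroutable tl hd s t (fun _ => (1 : ℝ)) x' ∧
      flowVal tl hd s t x' = flowVal tl hd s t x ∧
      ∀ a : A, arcFlow tl hd s t x' a ≤ arcFlow tl hd s t x a := by
  exact main_aux tl hd s t x hx hrf
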